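/- In the semi-infinite wedge space, let α_1 = Σ_l E_{l−1,l}. For any positive integer a and function f: e^{α_1} (Σ_l f(l) E_{l+a,l}) e^{−α_1} = Σ_l Σ_{t≥0} (Δ^t f)(l)/t! · E_{l+a−t,l} + (Δ^{a−1} f)(−1/2)/a! · Id, where Δ is the backward difference operator. -/

import Mathlib

/- Semi-infinite wedge (free fermion) formalism, in the Maya-diagram model.
A basis state of the Fock space is a subset `S ⊆ ℤ`, where the integer `a ∈ S`
represents the half-integer `l = a − 1/2` occurring in the semi-infinite wedge.
Thus the vacuum is `{a | a ≤ 0}`, a function `f : ℤ → K` encodes a function of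
`l ∈ ℤ+1/2` via `f a = f(a − 1/2)`, and `f(−1/2)` is `f 0`. -/

attribute [local instance] Classical.propDecidable

noncomputable section

/-- The Fock space: the free `K`-module on Maya diagrams `S : Set ℤ`. -/
abbrev Fock (K : Type) [Field K] := Set ℤ →₀ K

/-- Image of the basis vector `S` under the normally ordered operator
`E_{i−1/2, j−1/2}` (with the wedge-reordering sign). -/
def Ewedge (K : Type) [Field K] (i j : ℤ) (S : Set ℤ) : Fock K :=
  if i = j then
    (if 0 < i then (if i ∈ S then Finsupp.single S 1 else 0)
     else (if i ∈ S then 0 else -Finsupp.single S 1))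
  else
    if j ∈ S ∧ i ∉ S then
      ((-1 : K) ^ (S ∩ Set.Ioo (min i j) (max i j)).ncard) •
        Finsupp.single (insert i (S \ {j})) (1 : K)
    else 0

/-- The operator `Σ_{l ∈ ℤ+1/2} f(l) E_{l+a,l}`, extended linearly. -/
def sumE (K : Type) [Field K] (a : ℤ) (f : ℤ → K) : Module.End K (Fock K) :=
  Finsupp.lift (Fock K) K (Set ℤ) (fun S => ∑ᶠ l : ℤ, f l • Ewedge K (l + a) l S)

/-- `α_1 = Σ_l E_{l−1,l}`. -/
def alphaOne (K : Type) [Field K] : Module.End K (Fock K) :=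
  sumE K (-1) (fun _ => 1)

/-- The exponential `e^A v = Σ_n A^n v / n!` of a locally nilpotent operator
(a finite sum on each relevant vector, defined via `finsum`). -/
def expOp (K : Type) [Field K] (A : Module.End K (Fock K)) (v : Fock K) : Fock K :=
  ∑ᶠ n : ℕ, ((n.factorial : K)⁻¹) • (A ^ n) v

/-- Admissibility of a Maya diagram. -/
def Admissible (S : Set ℤ) : Prop :=
  {a | a ∈ S ∧ 0 < a}.Finite ∧ {a | a ∉ S ∧ a ≤ 0}.Finite

/-- Charge zero. -/
def ChargeZero (S : Set ℤ) : Prop :=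
  {a | a ∈ S ∧ 0 < a}.ncard = {a | a ∉ S ∧ a ≤ 0}.ncard

/-- The backward difference operator `(Δf)(l) = f(l) − f(l−1)`. -/
def bdiff (K : Type) [Field K] (f : ℤ → K) : ℤ → K := fun l => f l - f (l - 1)


def sg (M i : ℤ) (S : Set ℤ) : ℝ := ∏ x ∈ Finset.Ioc i M, (if x ∈ S then (-1 : ℝ) else 1)

lemma sg_flip (M i j : ℤ) (S T : Set ℤ) (h : ∀ x, x ≠ j → (x ∈ T ↔ x ∈ S))
    (hj : j ∈ T ↔ j ∉ S) :
    sg M i T = (if i < j ∧ j ≤ M then -1 else 1) * sg M i S := by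
  unfold sg
  split_ifs with hc
  · have hm : j ∈ Finset.Ioc i M := Finset.mem_Ioc.2 hc
    rw [← Finset.mul_prod_erase _ _ hm, ← Finset.mul_prod_erase _ (fun x => if x ∈ S then (-1 : ℝ) else 1) hm]
    have : ∏ x ∈ (Finset.Ioc i M).erase j, (if x ∈ T then (-1 : ℝ) else 1)
        = ∏ x ∈ (Finset.Ioc i M).erase j, (if x ∈ S then (-1 : ℝ) else 1) := by
      apply Finset.prod_congr rfl
      intro x hx
      simp only [h x (Finset.ne_of_mem_erase hx)]
    rw [this]
    by_cases hS : j ∈ S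
    · have : j ∉ T := by tauto
      simp [hS, this]
    · have : j ∈ T := by tauto
      simp [hS, this]
  · rw [one_mul]
    apply Finset.prod_congr rfl
    intro x hx
    have : x ≠ j := by
      rintro rfl
      exact hc (Finset.mem_Ioc.1 hx)
    simp only [h x this]

lemma sg_insert (M i j : ℤ) (S : Set ℤ) (hj : j ∉ S) :
    sg M i (insert j S) = (if i < j ∧ j ≤ M then -1 else 1) * sg M i S := by
  apply sg_flip
  · intro x hx; simp [hx]
  · simp [hj]

lemma sg_diff (M i j : ℤ) (S : Set ℤ) (hj : j ∈ S) :
    sg M i (S \ {j}) = (if i < j ∧ j ≤ M then -1 else 1) * sg M i S := by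
  apply sg_flip
  · intro x hx; simp [hx]
  · simp [hj]

lemma sg_sq (M i : ℤ) (S : Set ℤ) : sg M i S * sg M i S = 1 := by
  unfold sg
  rw [← Finset.prod_mul_distrib]
  apply Finset.prod_eq_one
  intro x _
  split_ifs <;> norm_num

lemma ncard_sign (i j : ℤ) (S : Set ℤ) :
    (-1 : ℝ) ^ (S ∩ Set.Ioo i j).ncard
      = ∏ x ∈ Finset.Ioo i j, (if x ∈ S then (-1 : ℝ) else 1) := by
  rw [Finset.prod_ite]
  simp only [Finset.prod_const, one_pow, mul_one]
  congr 1
  rw [← Set.ncard_coe_finset]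
  congr 1
  ext x
  simp [and_comm]

lemma sg_split (M i j : ℤ) (S : Set ℤ) (hij : i < j) (hj : j ≤ M) :
    sg M i S = (-1 : ℝ) ^ (S ∩ Set.Ioo i j).ncard * ((if j ∈ S then -1 else 1) * sg M j S) := by
  rw [ncard_sign]
  unfold sg
  have h1 : Finset.Ioc i M = Finset.Ioo i j ∪ insert j (Finset.Ioc j M) := by
    ext x; simp only [Finset.mem_Ioc, Finset.mem_union, Finset.mem_Ioo, Finset.mem_insert]; omega
  rw [h1, Finset.prod_union, Finset.prod_insert]
  · simp
  · rw [Finset.disjoint_left]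
    intro x hx
    simp only [Finset.mem_Ioc, Finset.mem_Ioo, Finset.mem_insert] at *
    omega

lemma lift_one (f : Set ℤ → Fock ℝ) (S : Set ℤ) :
    Finsupp.lift (Fock ℝ) ℝ (Set ℤ) f (Finsupp.single S 1) = f S := by
  rw [Finsupp.lift_apply, Finsupp.sum_single_index, one_smul]
  rw [zero_smul]

def psi (M i : ℤ) : Module.End ℝ (Fock ℝ) :=
  Finsupp.lift (Fock ℝ) ℝ (Set ℤ)
    (fun S => if i ∈ S then 0 else sg M i S • Finsupp.single (insert i S) (1 : ℝ))

def psis (M j : ℤ) : Module.End ℝ (Fock ℝ) :=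
  Finsupp.lift (Fock ℝ) ℝ (Set ℤ)
    (fun S => if j ∈ S then sg M j S • Finsupp.single (S \ {j}) (1 : ℝ) else 0)

def EE (i j : ℤ) : Module.End ℝ (Fock ℝ) :=
  Finsupp.lift (Fock ℝ) ℝ (Set ℤ) (Ewedge ℝ i j)

lemma psi_single (M i : ℤ) (S : Set ℤ) : psi M i (Finsupp.single S 1) =
    if i ∈ S then 0 else sg M i S • Finsupp.single (insert i S) (1 : ℝ) := by
  rw [psi, lift_one]

lemma psis_single (M i : ℤ) (S : Set ℤ) : psis M i (Finsupp.single S 1) =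
    if i ∈ S then sg M i S • Finsupp.single (S \ {i}) (1 : ℝ) else 0 := by
  rw [psis, lift_one]

lemma EE_single (i j : ℤ) (S : Set ℤ) : EE i j (Finsupp.single S 1) = Ewedge ℝ i j S := by
  rw [EE, lift_one]

lemma end_ext {A B : Module.End ℝ (Fock ℝ)}
    (h : ∀ S, A (Finsupp.single S 1) = B (Finsupp.single S 1)) : A = B := by
  apply Finsupp.lhom_ext'
  intro S
  apply LinearMap.ext_ring
  simpa using h S

lemma car_pp0 (M i j : ℤ) (hi : i ≤ M) (hj : j ≤ M) :
    psi M i * psi M j = - (psi M j * psi M i) := by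
  apply end_ext
  intro S
  simp only [Module.End.mul_apply, LinearMap.neg_apply, psi_single]
  by_cases hij : i = j
  · subst hij
    by_cases h : i ∈ S <;> simp [-Finsupp.smul_single, smul_smul, h, psi_single]
  · have hji : ¬ j = i := fun h => hij h.symm
    by_cases h : i ∈ S <;> by_cases h' : j ∈ S <;> simp [-Finsupp.smul_single, smul_smul, h, h', psi_single, hij, hji]
    rw [sg_insert _ _ _ _ h, sg_insert _ _ _ _ h', Set.insert_comm]
    rcases lt_or_gt_of_ne hij with hl | hl
    · simp [-Finsupp.smul_single, smul_smul, hl, hi, hj, hl.le, not_lt.2 hl.le, mul_comm]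
    · simp [-Finsupp.smul_single, smul_smul, hl, hi, hj, hl.le, not_lt.2 hl.le, mul_comm]

lemma car_ss0 (M i j : ℤ) (hi : i ≤ M) (hj : j ≤ M) :
    psis M i * psis M j = - (psis M j * psis M i) := by
  apply end_ext
  intro S
  simp only [Module.End.mul_apply, LinearMap.neg_apply, psis_single]
  by_cases hij : i = j
  · subst hij
    by_cases h : i ∈ S <;> simp [-Finsupp.smul_single, smul_smul, h, psis_single]
  · have hji : ¬ j = i := fun h => hij h.symm
    by_cases h : i ∈ S <;> by_cases h' : j ∈ S <;> simp [-Finsupp.smul_single, smul_smul, h, h', psis_single, hij, hji]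
    rw [sg_diff _ _ _ _ h, sg_diff _ _ _ _ h', Set.diff_diff_comm]
    rcases lt_or_gt_of_ne hij with hl | hl
    · simp [-Finsupp.smul_single, smul_smul, hl, hi, hj, hl.le, not_lt.2 hl.le, mul_comm]
    · simp [-Finsupp.smul_single, smul_smul, hl, hi, hj, hl.le, not_lt.2 hl.le, mul_comm]

lemma car_sp0 (M i j : ℤ) (hi : i ≤ M) (hj : j ≤ M) :
    psis M i * psi M j = (if i = j then 1 else 0) - (psi M j * psis M i) := by
  apply end_ext
  intro S
  simp only [Module.End.mul_apply, LinearMap.sub_apply, psis_single, psi_single]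
  by_cases hij : i = j
  · subst hij
    by_cases h : i ∈ S
    · simp [-Finsupp.smul_single, smul_smul, h, psis_single, psi_single, sg_diff, smul_smul, sg_sq, Set.insert_eq_of_mem]
    · simp [-Finsupp.smul_single, smul_smul, h, psis_single, psi_single, sg_insert, smul_smul, sg_sq]
  · have hji : ¬ j = i := fun h => hij h.symm
    by_cases h : i ∈ S <;> by_cases h' : j ∈ S <;> simp [-Finsupp.smul_single, smul_smul, h, h', psi_single, psis_single, hij, hji]
    rw [sg_diff _ _ _ _ h, sg_insert _ _ _ _ h', Set.insert_diff_of_notMem _ (by simpa using hji)]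
    rcases lt_or_gt_of_ne hij with hl | hl
    · simp [-Finsupp.smul_single, smul_smul, hl, hi, hj, hl.le, not_lt.2 hl.le, mul_comm]
    · simp [-Finsupp.smul_single, smul_smul, hl, hi, hj, hl.le, not_lt.2 hl.le, mul_comm]

lemma EE_eq0 (M i j : ℤ) (hi : i ≤ M) (hj : j ≤ M) :
    EE i j = psi M i * psis M j - (if i = j ∧ i ≤ 0 then 1 else 0) := by
  apply end_ext
  intro S
  simp only [Module.End.mul_apply, LinearMap.sub_apply, psis_single, EE_single, Ewedge]
  by_cases hij : i = j
  · subst hij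
    by_cases h : i ∈ S
    · by_cases h0 : 0 < i
      · simp [-Finsupp.smul_single, smul_smul, h, h0, psi_single, sg_diff, sg_sq, Set.insert_eq_of_mem, not_le.2 h0]
      · simp [-Finsupp.smul_single, smul_smul, h, h0, psi_single, sg_diff, sg_sq, Set.insert_eq_of_mem, not_lt.1 h0]
    · by_cases h0 : 0 < i
      · simp [-Finsupp.smul_single, smul_smul, h, h0, not_le.2 h0]
      · simp [-Finsupp.smul_single, smul_smul, h, h0, not_lt.1 h0]
  · have hji : ¬ j = i := fun h => hij h.symm
    by_cases h : i ∈ S <;> by_cases h' : j ∈ S <;> simp [-Finsupp.smul_single, smul_smul, h, h', psi_single, hij]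
    rw [sg_diff _ _ _ _ h']
    rcases lt_or_gt_of_ne hij with hl | hl
    · rw [sg_split M i j S hl hj]
      have := sg_sq M j S
      simp only [min_eq_left hl.le, max_eq_right hl.le, hl, hj, h', and_self, if_true]
      congr 1
      linear_combination (-(-1 : ℝ) ^ (S ∩ Set.Ioo i j).ncard) * this
    · rw [sg_split M j i S hl hi]
      have := sg_sq M i S
      simp only [min_eq_right hl.le, max_eq_left hl.le, not_lt.2 hl.le, h, false_and, if_false]
      congr 1
      linear_combination (-(-1 : ℝ) ^ (S ∩ Set.Ioo j i).ncard) * this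


lemma car_pp (M i j : ℤ) (hi : i ≤ M) (hj : j ≤ M) (v : Fock ℝ) :
    psi M i (psi M j v) = - psi M j (psi M i v) := LinearMap.congr_fun (car_pp0 M i j hi hj) v

lemma car_ss (M i j : ℤ) (hi : i ≤ M) (hj : j ≤ M) (v : Fock ℝ) :
    psis M i (psis M j v) = - psis M j (psis M i v) := LinearMap.congr_fun (car_ss0 M i j hi hj) v

lemma car_sp (M i j : ℤ) (hi : i ≤ M) (hj : j ≤ M) (v : Fock ℝ) :
    psis M i (psi M j v) = (if i = j then v else 0) - psi M j (psis M i v) := by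
  have := LinearMap.congr_fun (car_sp0 M i j hi hj) v
  rw [LinearMap.sub_apply] at this
  split_ifs at this ⊢ <;> exact this

lemma EE_eq (M i j : ℤ) (hi : i ≤ M) (hj : j ≤ M) (v : Fock ℝ) :
    EE i j v = psi M i (psis M j v) - (if i = j ∧ i ≤ 0 then v else 0) := by
  have := LinearMap.congr_fun (EE_eq0 M i j hi hj) v
  rw [LinearMap.sub_apply] at this
  split_ifs at this ⊢ <;> exact this

lemma bilin_comm (M i j k l : ℤ) (hi : i ≤ M) (hj : j ≤ M) (hk : k ≤ M) (hl : l ≤ M) (v : Fock ℝ) :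
    psi M i (psis M j (psi M k (psis M l v))) - psi M k (psis M l (psi M i (psis M j v)))
      = (if j = k then psi M i (psis M l v) else 0) - (if l = i then psi M k (psis M j v) else 0) := by
  rw [car_sp M j k hj hk, car_sp M l i hl hi, map_sub, map_sub, car_pp M i k hi hk,
    car_ss M j l hj hl, map_neg, map_neg, neg_neg]
  split_ifs <;> simp <;> abel

lemma EE_comm (k i j : ℤ) (v : Fock ℝ) :
    EE (k - 1) k (EE i j v) - EE i j (EE (k - 1) k v)
      = (if k = i then EE (i - 1) j v else 0) - (if k = j + 1 then EE i (j + 1) v else 0)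
        + (if k = i then (if i = j + 1 ∧ j = 0 then v else 0) else 0) := by
  obtain ⟨M, hk, hi, hj⟩ : ∃ M : ℤ, k ≤ M ∧ i ≤ M ∧ j + 1 ≤ M :=
    ⟨max k (max i (j + 1)), by simp, by simp, by simp⟩
  have key := bilin_comm M (k - 1) k i j (by omega) hk hi (by omega) v
  have h0 : ¬ (k - 1 = k ∧ k - 1 ≤ 0) := by omega
  have hA : ∀ w, EE (k - 1) k w = psi M (k - 1) (psis M k w) := by
    intro w
    rw [EE_eq M (k - 1) k (by omega) hk, if_neg h0, sub_zero]
  rw [hA, hA, EE_eq M i j hi (by omega), EE_eq M i j hi (by omega),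
    EE_eq M (i-1) j (by omega) (by omega), EE_eq M i (j+1) hi hj]
  rw [map_sub, map_sub]
  have h5 : psi M (k - 1) (psis M k (if i = j ∧ i ≤ 0 then v else 0))
     = if i = j ∧ i ≤ 0 then psi M (k - 1) (psis M k v) else 0 := by
    split_ifs <;> simp
  rw [h5, sub_sub_sub_cancel_right, key]
  have hjk : (j = k - 1) ↔ k = j + 1 := by omega
  simp only [hjk]
  by_cases h1 : k = i
  · subst h1
    by_cases h2 : k = j + 1
    · subst h2
      by_cases h3 : j = 0
      · subst h3; simp; abel
      · by_cases h4 : j + 1 ≤ 0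
        · have : j ≤ 0 := by omega
          simp [h3, h4, this]
        · have : ¬ j ≤ 0 := by omega
          simp [h3, h4, this]
    · have : ¬ (k - 1 = j) := by omega
      simp [h2, this]
  · by_cases h2 : k = j + 1
    · subst h2
      have : ¬ (i = j + 1) := fun h => h1 h.symm
      simp [h1, this]
    · simp [h1, h2]


def Adm (N : ℕ) (S : Set ℤ) : Prop := (∀ x : ℤ, x ≤ -N → x ∈ S) ∧ (∀ x : ℤ, (N : ℤ) < x → x ∉ S)

lemma exists_Adm {S : Set ℤ} (hS : Admissible S) : ∃ N, Adm N S := by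
  obtain ⟨h1, h2⟩ := hS
  obtain ⟨b, hb⟩ := h1.bddAbove
  obtain ⟨c, hc⟩ := h2.bddBelow
  refine ⟨b.toNat + c.natAbs + 1, ?_, ?_⟩
  · intro x hx
    by_contra hxS
    have := hc (show x ∈ {a | a ∉ S ∧ a ≤ 0} from ⟨hxS, by omega⟩)
    omega
  · intro x hx hxS
    have := hb (show x ∈ {a | a ∈ S ∧ 0 < a} from ⟨hxS, by omega⟩)
    omega

/-- Vectors supported on states satisfying `P`. -/
abbrev VV (P : Set ℤ → Prop) : Submodule ℝ (Fock ℝ) := Finsupp.supported ℝ ℝ {S | P S}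

lemma VV_induction {P : Set ℤ → Prop} {p : Fock ℝ → Prop} (h0 : p 0)
    (hadd : ∀ u v, p u → p v → p (u + v)) (hsmul : ∀ (c : ℝ) v, p v → p (c • v))
    (hs : ∀ S, P S → p (Finsupp.single S 1)) (v : Fock ℝ) (hv : v ∈ VV P) : p v := by
  rw [VV, Finsupp.supported_eq_span_single] at hv
  induction hv using Submodule.span_induction with
  | mem x hx =>
    obtain ⟨S, hS, rfl⟩ := hx
    exact hs S hS
  | zero => exact h0
  | add x y _ _ hx hy => exact hadd x y hx hy
  | smul c x _ hx => exact hsmul c x hx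

lemma VV_single {P : Set ℤ → Prop} {S : Set ℤ} (h : P S) : Finsupp.single S (1 : ℝ) ∈ VV P :=
  Finsupp.single_mem_supported ℝ 1 h

lemma VV_map {P : Set ℤ → Prop} {W : Submodule ℝ (Fock ℝ)} (A : Module.End ℝ (Fock ℝ))
    (hs : ∀ S, P S → A (Finsupp.single S 1) ∈ W) (v : Fock ℝ) (hv : v ∈ VV P) : A v ∈ W := by
  refine VV_induction (p := fun v => A v ∈ W) ?_ ?_ ?_ hs v hv
  · rw [map_zero]; exact W.zero_mem
  · intro u v hu hv; rw [map_add]; exact W.add_mem hu hv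
  · intro c v hv; rw [map_smul]; exact W.smul_mem c hv

lemma finsum_mem_sub {ι : Type} (W : Submodule ℝ (Fock ℝ)) (g : ι → Fock ℝ) (h : ∀ i, g i ∈ W) :
    ∑ᶠ i, g i ∈ W :=
  finsum_induction (fun x => x ∈ W) W.zero_mem (fun _ _ => W.add_mem) h

/-- Non-vanishing of an elementary operator on an admissible state. -/
lemma Ewedge_ne {N : ℕ} {S : Set ℤ} (hS : Adm N S) (l b : ℤ) (h : Ewedge ℝ (l + b) l S ≠ 0) :
    l ∈ Set.Icc (-(N : ℤ) - b.natAbs) (N + b.natAbs) ∧ -(2 * (N : ℤ)) ≤ b := by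
  unfold Ewedge at h
  have h1 := hS.1
  have h2 := hS.2
  by_cases hb : l + b = l
  · have hb0 : b = 0 := by omega
    subst hb0
    rw [if_pos hb] at h
    rw [hb] at h
    refine ⟨?_, by omega⟩
    simp only [Set.mem_Icc]
    by_cases h0 : 0 < l
    · rw [if_pos h0] at h
      by_cases hl : l ∈ S
      · have : ¬ ((N : ℤ) < l) := fun h => h2 l h hl
        omega
      · simp [hl] at h
    · rw [if_neg h0] at h
      by_cases hl : l ∈ S
      · simp [hl] at h
      · have : ¬ (l ≤ -(N : ℤ)) := fun h => hl (h1 l h)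
        omega
  · rw [if_neg hb] at h
    by_cases hc : l ∈ S ∧ l + b ∉ S
    · have a1 : ¬ ((N : ℤ) < l) := fun h => h2 l h hc.1
      have a2 : ¬ (l + b ≤ -(N : ℤ)) := fun h => hc.2 (h1 _ h)
      simp only [Set.mem_Icc]
      omega
    · rw [if_neg hc] at h
      exact absurd rfl h

lemma EE_zero {N : ℕ} (l b : ℤ) (hl : ¬ (l ∈ Set.Icc (-(N : ℤ) - b.natAbs) (N + b.natAbs) ∧
    -(2 * (N : ℤ)) ≤ b)) (v : Fock ℝ) (hv : v ∈ VV (Adm N)) : EE (l + b) l v = 0 := by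
  have := VV_map (W := ⊥) (EE (l + b) l) (fun S hS => by
    rw [EE_single, Submodule.mem_bot]
    by_contra h
    exact hl (Ewedge_ne hS l b h)) v hv
  simpa using this

lemma EE_supp {N : ℕ} (b : ℤ) (g : ℤ → ℝ) (v : Fock ℝ) (hv : v ∈ VV (Adm N)) :
    (Function.support fun l => g l • EE (l + b) l v).Finite := by
  apply (Set.finite_Icc (-(N : ℤ) - b.natAbs) (N + b.natAbs)).subset
  intro l hl
  by_contra h
  apply hl
  simp only
  rw [EE_zero l b (fun h' => h h'.1) v hv, smul_zero]

lemma sumE_apply {N : ℕ} (b : ℤ) (g : ℤ → ℝ) (v : Fock ℝ) (hv : v ∈ VV (Adm N)) :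
    sumE ℝ b g v = ∑ᶠ l : ℤ, g l • EE (l + b) l v := by
  have e : ∀ v ∈ VV (Adm N), ∑ᶠ l : ℤ, g l • EE (l + b) l v
      = ∑ l ∈ Finset.Icc (-(N : ℤ) - b.natAbs) (N + b.natAbs), g l • EE (l + b) l v := by
    intro v hv
    apply finsum_eq_sum_of_support_subset
    intro l hl
    by_contra h
    apply hl
    simp only
    rw [EE_zero l b (fun h' => h (by simpa using h'.1)) v hv, smul_zero]
  rw [e v hv]
  refine VV_induction (P := Adm N) (p := fun v => sumE ℝ b g v = ∑ l ∈ Finset.Icc (-(N : ℤ) - b.natAbs) (N + b.natAbs), g l • EE (l + b) l v) ?_ ?_ ?_ ?_ v hv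
  · simp only [map_zero, smul_zero, Finset.sum_const_zero]
  · intro u v hu hv
    simp only [map_add, smul_add, Finset.sum_add_distrib]
    rw [hu, hv]
  · intro c v hv
    simp only [map_smul]
    rw [hv, Finset.smul_sum]
    exact Finset.sum_congr rfl fun l _ => smul_comm _ _ _
  · intro S hS
    rw [← e _ (VV_single hS), sumE, lift_one]
    simp only [EE_single]

lemma sumE_zero {N : ℕ} (b : ℤ) (hb : b < -(2 * (N : ℤ))) (g : ℤ → ℝ) (v : Fock ℝ)
    (hv : v ∈ VV (Adm N)) : sumE ℝ b g v = 0 := by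
  rw [sumE_apply b g v hv]
  apply finsum_eq_zero_of_forall_eq_zero
  intro l
  rw [EE_zero l b (fun h' => by have := h'.2; omega) v hv, smul_zero]

lemma EE_mem {N : ℕ} (i j : ℤ) (v : Fock ℝ) (hv : v ∈ VV (Adm N)) :
    EE i j v ∈ VV (Adm (N + i.natAbs + j.natAbs + 1)) := by
  refine VV_map _ ?_ v hv
  intro S hS
  have h1 := hS.1
  have h2 := hS.2
  have hS' : Adm (N + i.natAbs + j.natAbs + 1) S :=
    ⟨fun x hx => h1 x (by omega), fun x hx => h2 x (by omega)⟩
  rw [EE_single, Ewedge]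
  split_ifs
  · exact VV_single hS'
  · exact Submodule.zero_mem _
  · exact Submodule.zero_mem _
  · exact Submodule.neg_mem _ (VV_single hS')
  · apply Submodule.smul_mem
    apply VV_single
    constructor
    · intro x hx
      right
      refine ⟨h1 x (by omega), ?_⟩
      simp only [Set.mem_singleton_iff]
      omega
    · rintro x hx (h | h)
      · omega
      · exact h2 x (by omega) h.1
  · exact Submodule.zero_mem _

def energy (N : ℕ) (S : Set ℤ) : ℕ :=
  ∑ x ∈ (Finset.Ioc (-(N : ℤ)) N).filter (· ∈ S), (x + N).toNat

lemma energy_move {N : ℕ} {S : Set ℤ} (hS : Adm N S) (l : ℤ) (h : l ∈ S) (h' : l - 1 ∉ S) :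
    Adm N (insert (l - 1) (S \ {l})) ∧
      energy N (insert (l - 1) (S \ {l})) + 1 = energy N S := by
  have h1 := hS.1
  have h2 := hS.2
  have a1 : ¬ ((N : ℤ) < l) := fun hh => h2 l hh h
  have a2 : ¬ (l - 1 ≤ -(N : ℤ)) := fun hh => h' (h1 _ hh)
  refine ⟨⟨?_, ?_⟩, ?_⟩
  · intro x hx
    right
    refine ⟨h1 x (by omega), ?_⟩
    simp only [Set.mem_singleton_iff]
    omega
  · rintro x hx (h | h)
    · omega
    · exact h2 x (by omega) h.1
  · unfold energy
    have hm : l ∈ (Finset.Ioc (-(N : ℤ)) N).filter (· ∈ S) := by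
      simp only [Finset.mem_filter, Finset.mem_Ioc]
      exact ⟨by omega, h⟩
    have e : @Finset.filter ℤ (fun x => x ∈ insert (l - 1) (S \ {l}))
        (fun _ => Classical.propDecidable _) (Finset.Ioc (-(N : ℤ)) N)
        = insert (l - 1) (((Finset.Ioc (-(N : ℤ)) N).filter (· ∈ S)).erase l) := by
      ext x
      simp only [Finset.mem_filter, Finset.mem_Ioc, Finset.mem_insert, Finset.mem_erase,
        Set.mem_insert_iff, Set.mem_diff, Set.mem_singleton_iff]
      constructor
      · tauto
      · rintro (rfl | hx)
        · exact ⟨by omega, Or.inl rfl⟩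
        · tauto
    rw [e, Finset.sum_insert, ← Finset.add_sum_erase _ _ hm]
    · omega
    · simp [h']

lemma alpha_energy {N n : ℕ} (v : Fock ℝ) (hv : v ∈ VV (fun S => Adm N S ∧ energy N S < n + 1)) :
    alphaOne ℝ v ∈ VV (fun S => Adm N S ∧ energy N S < n) := by
  refine VV_map _ ?_ v hv
  rintro S ⟨hS, hn⟩
  rw [alphaOne, sumE, lift_one]
  apply finsum_mem_sub
  intro l
  apply Submodule.smul_mem
  rw [Ewedge, if_neg (by omega)]
  split_ifs with hc
  · apply Submodule.smul_mem
    apply VV_single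
    have := energy_move hS l hc.1 hc.2
    exact ⟨this.1, by have := this.2; simp only [← sub_eq_add_neg]; omega⟩
  · exact Submodule.zero_mem _

lemma alpha_mem {N : ℕ} (v : Fock ℝ) (hv : v ∈ VV (Adm N)) : alphaOne ℝ v ∈ VV (Adm N) := by
  refine VV_map _ ?_ v hv
  intro S hS
  rw [alphaOne, sumE, lift_one]
  apply finsum_mem_sub
  intro l
  apply Submodule.smul_mem
  rw [Ewedge, if_neg (by omega)]
  split_ifs with hc
  · apply Submodule.smul_mem
    apply VV_single
    exact (energy_move hS l hc.1 hc.2).1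
  · exact Submodule.zero_mem _

lemma alpha_pow_mem {N : ℕ} (n : ℕ) (v : Fock ℝ) (hv : v ∈ VV (Adm N)) :
    ((alphaOne ℝ) ^ n) v ∈ VV (Adm N) := by
  induction n with
  | zero => simpa using hv
  | succ n ih => rw [pow_succ', Module.End.mul_apply]; exact alpha_mem _ ih

lemma alpha_pow_zero' {N : ℕ} (n : ℕ) : ∀ (v : Fock ℝ),
    v ∈ VV (fun S => Adm N S ∧ energy N S < n) → ((alphaOne ℝ) ^ n) v = 0 := by
  induction n with
  | zero => 
    intro v hv
    have : {S : Set ℤ | Adm N S ∧ energy N S < 0} = ∅ := by ext; simp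
    rw [VV, this, Finsupp.supported_empty] at hv
    simpa using hv
  | succ n ih => 
    intro v hv
    rw [pow_succ, Module.End.mul_apply]
    exact ih _ (alpha_energy v hv)

lemma alpha_nil {N : ℕ} (v : Fock ℝ) (hv : v ∈ VV (Adm N)) :
    ∃ n, ∀ m, n ≤ m → ((alphaOne ℝ) ^ m) v = 0 := by
  have key : ∃ n, ((alphaOne ℝ) ^ n) v = 0 ∧ True := by
    refine ⟨v.support.sup (energy N) + 1, alpha_pow_zero' (N := N) _ v ?_, trivial⟩
    rw [Finsupp.mem_supported] at hv ⊢
    intro S hS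
    exact ⟨hv hS, Nat.lt_succ_of_le (Finset.le_sup (f := energy N) hS)⟩
  obtain ⟨n, hn, -⟩ := key
  refine ⟨n, fun m hm => ?_⟩
  obtain ⟨d, rfl⟩ := Nat.exists_eq_add_of_le' hm
  rw [pow_add, Module.End.mul_apply, hn, map_zero]

lemma alpha_apply {N : ℕ} (v : Fock ℝ) (hv : v ∈ VV (Adm N)) :
    alphaOne ℝ v = ∑ᶠ k : ℤ, EE (k - 1) k v := by
  rw [alphaOne, sumE_apply _ _ v hv]
  simp only [one_smul, ← sub_eq_add_neg]

lemma alpha_supp {N : ℕ} (v : Fock ℝ) (hv : v ∈ VV (Adm N)) :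
    (Function.support fun k : ℤ => EE (k - 1) k v).Finite := by
  have := EE_supp (-1) (fun _ => 1) v hv
  simpa only [one_smul, ← sub_eq_add_neg] using this

lemma finsum_ite (i : ℤ) (x : Fock ℝ) : ∑ᶠ k : ℤ, (if k = i then x else 0) = x := by
  rw [finsum_eq_single _ i (fun k hk => if_neg hk), if_pos rfl]

lemma supp_ite (i : ℤ) (x : Fock ℝ) :
    (Function.support fun k : ℤ => (if k = i then x else 0)).Finite := by
  apply (Set.finite_singleton i).subset
  intro k hk
  by_contra h
  exact hk (if_neg h)

lemma alpha_EE {N : ℕ} (i j : ℤ) (v : Fock ℝ) (hv : v ∈ VV (Adm N)) :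
    alphaOne ℝ (EE i j v) - EE i j (alphaOne ℝ v)
      = EE (i - 1) j v - EE i (j + 1) v + (if i = j + 1 ∧ j = 0 then v else 0) := by
  have hs := alpha_supp v hv
  have hs' : (Function.support fun k : ℤ => EE i j (EE (k - 1) k v)).Finite := by
    apply hs.subset
    intro k hk h
    apply hk
    simp only at h ⊢
    rw [h, map_zero]
  rw [alpha_apply _ (EE_mem i j v hv), alpha_apply v hv, map_finsum _ hs,
    ← finsum_sub_distrib (alpha_supp _ (EE_mem i j v hv)) hs']
  simp only [EE_comm]
  rw [finsum_add_distrib, finsum_sub_distrib (supp_ite _ _) (supp_ite _ _), finsum_ite, finsum_ite,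
    finsum_ite]
  · apply ((supp_ite i (EE (i - 1) j v)).union (supp_ite (j + 1) (EE i (j + 1) v))).subset
    exact Function.support_sub _ _
  · exact supp_ite _ _

lemma alpha_sumE {N : ℕ} (b : ℤ) (g : ℤ → ℝ) (v : Fock ℝ) (hv : v ∈ VV (Adm N)) :
    alphaOne ℝ (sumE ℝ b g v) = sumE ℝ (b - 1) (bdiff ℝ g) v + (if b = 1 then g 0 • v else 0)
      + sumE ℝ b g (alphaOne ℝ v) := by
  have hav := alpha_mem v hv
  rw [← sub_eq_iff_eq_add, sumE_apply b g v hv, sumE_apply b g _ hav, sumE_apply (b - 1) _ v hv,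
    map_finsum _ (EE_supp b g v hv)]
  have s1 : (Function.support fun l => alphaOne ℝ (g l • EE (l + b) l v)).Finite := by
    apply (EE_supp b g v hv).subset
    intro k hk h
    apply hk
    simp only at h ⊢
    rw [h, map_zero]
  rw [← finsum_sub_distrib s1 (EE_supp b g _ hav)]
  have e1 : ∀ l : ℤ, alphaOne ℝ (g l • EE (l + b) l v) - g l • EE (l + b) l (alphaOne ℝ v)
      = g l • EE (l + (b - 1)) l v - g l • EE (l + b) (l + 1) v
        + (if l = 0 then (if b = 1 then g 0 • v else 0) else 0) := by
    intro l
    rw [map_smul, ← smul_sub, alpha_EE (l + b) l v hv, smul_add, smul_sub]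
    congr 1
    · rw [show l + b - 1 = l + (b - 1) by ring]
    · by_cases hl : l = 0
      · subst hl
        by_cases hb : b = 1
        · simp [hb]
        · simp [hb]
      · simp [hl]
  simp only [e1]
  have s2 := EE_supp (b - 1) g v hv
  have s3 : (Function.support fun l => g (l - 1) • EE (l + (b - 1)) l v).Finite :=
    EE_supp (b - 1) (fun l => g (l - 1)) v hv
  have e4 : ∀ l : ℤ, g l • EE (l + b) (l + 1) v
      = (fun l => g (l - 1) • EE (l + (b - 1)) l v) (Equiv.addRight (1 : ℤ) l) := by
    intro l
    simp only [Equiv.coe_addRight]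
    rw [show l + 1 - 1 = l by ring, show l + 1 + (b - 1) = l + b by ring]
  have s4 : (Function.support fun l => g l • EE (l + b) (l + 1) v).Finite := by
    simp only [e4]
    exact s3.preimage (Equiv.injective _).injOn
  rw [finsum_add_distrib _ (supp_ite _ _), finsum_ite, finsum_sub_distrib s2 s4]
  · congr 1
    rw [finsum_congr e4, finsum_comp_equiv (Equiv.addRight (1 : ℤ))
      (f := fun l => g (l - 1) • EE (l + (b - 1)) l v), ← finsum_sub_distrib s2 s3]
    simp only [← sub_smul, bdiff]
  · exact (s2.union s4).subset (Function.support_sub _ _)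


lemma finsum_antidiag (F : ℕ → ℕ → Fock ℝ) (K : ℕ) (h1 : ∀ k p, K ≤ k → F k p = 0)
    (h2 : ∀ k p, K ≤ p → F k p = 0) :
    ∑ᶠ n : ℕ, ∑ x ∈ Finset.HasAntidiagonal.antidiagonal n, F x.1 x.2 = ∑ᶠ k : ℕ, ∑ᶠ p : ℕ, F k p := by
  have e1 : ∀ k, ∑ᶠ p : ℕ, F k p = ∑ p ∈ Finset.range K, F k p := by
    intro k
    apply finsum_eq_sum_of_support_subset
    intro p hp
    by_contra h
    exact hp (h2 k p (by simpa using h))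
  have e2 : ∑ᶠ k : ℕ, ∑ᶠ p : ℕ, F k p = ∑ k ∈ Finset.range K, ∑ p ∈ Finset.range K, F k p := by
    simp only [e1]
    apply finsum_eq_sum_of_support_subset
    intro k hk
    by_contra h
    exact hk (Finset.sum_eq_zero fun p _ => h1 k p (by simpa using h))
  have e3 : ∑ᶠ n : ℕ, ∑ x ∈ Finset.HasAntidiagonal.antidiagonal n, F x.1 x.2
      = ∑ n ∈ Finset.range (2 * K), ∑ x ∈ Finset.HasAntidiagonal.antidiagonal n, F x.1 x.2 := by
    apply finsum_eq_sum_of_support_subset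
    intro n hn
    by_contra h
    apply hn
    apply Finset.sum_eq_zero
    intro x hx
    rw [Finset.HasAntidiagonal.mem_antidiagonal] at hx
    have h : 2 * K ≤ n := by simpa using h
    by_cases hk : K ≤ x.1
    · exact h1 _ _ hk
    · exact h2 _ _ (by omega)
  rw [e2, e3, ← Finset.sum_product', Finset.sum_sigma']
  symm
  apply Finset.sum_of_injOn (fun x => ⟨x.1 + x.2, x⟩)
  · intro x _ y _ h
    simpa using congrArg (fun s => s.2) h
  · intro x hx
    simp at hx ⊢
    omega
  · rintro ⟨n, k, p⟩ hx hn
    simp only [Finset.mem_sigma, Finset.mem_range, Finset.HasAntidiagonal.mem_antidiagonal] at hx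
    by_cases hk : K ≤ k
    · exact h1 _ _ hk
    · by_cases hp : K ≤ p
      · exact h2 _ _ hp
      · exfalso
        apply hn
        refine ⟨(k, p), ?_, ?_⟩
        · simp; omega
        · obtain ⟨_, rfl⟩ := hx
          rfl
  · intro x _; rfl

def Cop (a : ℤ) (f : ℤ → ℝ) (k : ℕ) : Module.End ℝ (Fock ℝ) :=
  sumE ℝ (a - k) ((bdiff ℝ)^[k] f) +
    (if (k : ℤ) = a then (bdiff ℝ)^[(a - 1).toNat] f 0 else 0) • LinearMap.id

lemma Cop_apply (a : ℤ) (f : ℤ → ℝ) (k : ℕ) (v : Fock ℝ) : Cop a f k v =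
    sumE ℝ (a - k) ((bdiff ℝ)^[k] f) v +
    (if (k : ℤ) = a then (bdiff ℝ)^[(a - 1).toNat] f 0 else 0) • v := rfl

lemma Cop_step {N : ℕ} (a : ℤ) (f : ℤ → ℝ) (k : ℕ) (v : Fock ℝ)
    (hv : v ∈ VV (Adm N)) :
    alphaOne ℝ (Cop a f k v) = Cop a f (k + 1) v + Cop a f k (alphaOne ℝ v) := by
  rw [Cop_apply, Cop_apply, Cop_apply, map_add, map_smul, alpha_sumE _ _ v hv,
    Function.iterate_succ_apply']
  have h1 : (a - k - 1 : ℤ) = a - ((k + 1 : ℕ) : ℤ) := by push_cast; ring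
  have h2 : (if a - (k : ℤ) = 1 then ((bdiff ℝ)^[k] f) 0 • v else 0)
      = (if ((k + 1 : ℕ) : ℤ) = a then (bdiff ℝ)^[(a - 1).toNat] f 0 else 0) • v := by
    by_cases h : a - (k : ℤ) = 1
    · have h3 : ((k + 1 : ℕ) : ℤ) = a := by push_cast; omega
      have h4 : (a - 1).toNat = k := by omega
      rw [if_pos h, if_pos h3, h4]
    · have h3 : ¬ ((k + 1 : ℕ) : ℤ) = a := by push_cast; omega
      rw [if_neg h, if_neg h3, zero_smul]
  rw [h1, h2]
  abel

lemma Cop_pow {N : ℕ} (a : ℤ) (ha : 1 ≤ a) (f : ℤ → ℝ) (n : ℕ) (v : Fock ℝ)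
    (hv : v ∈ VV (Adm N)) :
    ((alphaOne ℝ) ^ n) (sumE ℝ a f v)
      = ∑ x ∈ Finset.HasAntidiagonal.antidiagonal n, n.choose x.1 • Cop a f x.1 (((alphaOne ℝ) ^ x.2) v) := by
  induction n with
  | zero =>
    have : ¬ (0 : ℤ) = a := by omega
    simp [Cop_apply, this]
  | succ n ih =>
    rw [pow_succ', Module.End.mul_apply, ih,
      Finset.sum_antidiagonal_choose_succ_nsmul
        (fun k p => Cop a f k (((alphaOne ℝ) ^ p) v)), map_sum, ← Finset.sum_add_distrib]
    apply Finset.sum_congr rfl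
    intro x hx
    rw [map_nsmul, Cop_step a f x.1 _ (alpha_pow_mem x.2 v hv), pow_succ', Module.End.mul_apply,
      smul_add, add_comm]
    congr 2
    rw [Finset.HasAntidiagonal.mem_antidiagonal] at hx
    rw [← hx]
    exact Nat.choose_symm_add

lemma fact_smul (n : ℕ) (x : ℕ × ℕ) (hx : x ∈ Finset.HasAntidiagonal.antidiagonal n) (w : Fock ℝ) :
    ((n.factorial : ℝ)⁻¹) • (n.choose x.1 • w)
      = ((x.1.factorial : ℝ)⁻¹ * (x.2.factorial : ℝ)⁻¹) • w := by
  rw [Finset.HasAntidiagonal.mem_antidiagonal] at hx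
  subst hx
  rw [← Nat.cast_smul_eq_nsmul ℝ, smul_smul]
  congr 1
  have h := Nat.add_choose_mul_factorial_mul_factorial x.1 x.2
  rw [← Nat.choose_symm_add] at h
  have h' : ((x.1 + x.2).choose x.1 : ℝ) * x.1.factorial * x.2.factorial = (x.1 + x.2).factorial := by
    exact_mod_cast h
  have a1 : (x.1.factorial : ℝ) ≠ 0 := by exact_mod_cast Nat.factorial_ne_zero _
  have a2 : (x.2.factorial : ℝ) ≠ 0 := by exact_mod_cast Nat.factorial_ne_zero _
  have a3 : ((x.1 + x.2).factorial : ℝ) ≠ 0 := by exact_mod_cast Nat.factorial_ne_zero _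
  field_simp
  linear_combination h'

lemma neg_pow_apply (A : Module.End ℝ (Fock ℝ)) (n : ℕ) (v : Fock ℝ) :
    ((-A) ^ n) v = ((-1 : ℝ) ^ n) • (A ^ n) v := by
  induction n with
  | zero => simp
  | succ n ih =>
    rw [pow_succ', Module.End.mul_apply, ih, pow_succ' A, Module.End.mul_apply, LinearMap.neg_apply,
      map_smul, pow_succ, mul_smul]
    simp

lemma exp_supp {A : Module.End ℝ (Fock ℝ)} {v : Fock ℝ} {n : ℕ}
    (h : ∀ m, n ≤ m → (A ^ m) v = 0) :
    (Function.support fun m : ℕ => ((m.factorial : ℝ)⁻¹) • (A ^ m) v).Finite := by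
  apply (Finset.range n).finite_toSet.subset
  intro m hm
  by_contra hc
  apply hm
  simp only
  rw [h m (by simpa using hc), smul_zero]

lemma alt_sum (n : ℕ) : (∑ x ∈ Finset.HasAntidiagonal.antidiagonal n,
    ((x.1.factorial : ℝ)⁻¹ * ((x.2.factorial : ℝ)⁻¹ * (-1) ^ x.2)) : ℝ) = if n = 0 then 1 else 0 := by
  have h : (n.factorial : ℝ) ≠ 0 := by exact_mod_cast Nat.factorial_ne_zero _
  have h2 := (Commute.all (1 : ℝ) (-1)).add_pow' n
  have : (∑ x ∈ Finset.HasAntidiagonal.antidiagonal n,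
    ((x.1.factorial : ℝ)⁻¹ * ((x.2.factorial : ℝ)⁻¹ * (-1) ^ x.2)) : ℝ)
      = (n.factorial : ℝ)⁻¹ * (1 + -1) ^ n := by
    rw [h2, Finset.mul_sum]
    apply Finset.sum_congr rfl
    intro x hx
    rw [Finset.HasAntidiagonal.mem_antidiagonal] at hx
    subst hx
    have h := Nat.add_choose_mul_factorial_mul_factorial x.1 x.2
    rw [← Nat.choose_symm_add] at h
    have h' : ((x.1 + x.2).choose x.1 : ℝ) * x.1.factorial * x.2.factorial = (x.1 + x.2).factorial := by
      exact_mod_cast h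
    have a1 : (x.1.factorial : ℝ) ≠ 0 := by exact_mod_cast Nat.factorial_ne_zero _
    have a2 : (x.2.factorial : ℝ) ≠ 0 := by exact_mod_cast Nat.factorial_ne_zero _
    have a3 : ((x.1 + x.2).factorial : ℝ) ≠ 0 := by exact_mod_cast Nat.factorial_ne_zero _
    rw [nsmul_eq_mul, ← h']
    rw [← h'] at a3
    have a4 : ((x.1 + x.2).choose x.1 : ℝ) ≠ 0 := fun h => a3 (by rw [h]; ring)
    field_simp
    simp
  rw [this]
  by_cases hn : n = 0
  · subst hn; simp
  · simp [hn]

lemma exp_cancel {N : ℕ} (v : Fock ℝ) (hv : v ∈ VV (Adm N)) :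
    expOp ℝ (alphaOne ℝ) (expOp ℝ (-(alphaOne ℝ)) v) = v := by
  obtain ⟨n, hn⟩ := alpha_nil v hv
  have hn' : ∀ m, n ≤ m → ((-(alphaOne ℝ)) ^ m) v = 0 := by
    intro m hm
    rw [neg_pow_apply, hn m hm, smul_zero]
  unfold expOp
  have e : ∀ k : ℕ, ((k.factorial : ℝ)⁻¹) • ((alphaOne ℝ) ^ k)
      (∑ᶠ p : ℕ, ((p.factorial : ℝ)⁻¹) • ((-(alphaOne ℝ)) ^ p) v)
      = ∑ᶠ p : ℕ, ((k.factorial : ℝ)⁻¹ * ((p.factorial : ℝ)⁻¹ * (-1) ^ p)) •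
          ((alphaOne ℝ) ^ (k + p)) v := by
    intro k
    rw [map_finsum _ (exp_supp hn'), smul_finsum]
    apply finsum_congr
    intro p
    rw [map_smul, neg_pow_apply, map_smul, pow_add, Module.End.mul_apply, smul_smul, smul_smul]
    congr 1
    ring
  rw [finsum_congr e, ← finsum_antidiag _ n]
  · have e2 : ∀ m : ℕ, ∑ x ∈ Finset.HasAntidiagonal.antidiagonal m,
        ((x.1.factorial : ℝ)⁻¹ * ((x.2.factorial : ℝ)⁻¹ * (-1) ^ x.2)) •
          ((alphaOne ℝ) ^ (x.1 + x.2)) v = if m = 0 then v else 0 := by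
      intro m
      have : ∀ x ∈ Finset.HasAntidiagonal.antidiagonal m, 
          ((x.1.factorial : ℝ)⁻¹ * ((x.2.factorial : ℝ)⁻¹ * (-1) ^ x.2)) •
          ((alphaOne ℝ) ^ (x.1 + x.2)) v = ((x.1.factorial : ℝ)⁻¹ * ((x.2.factorial : ℝ)⁻¹ * (-1) ^ x.2)) •
          ((alphaOne ℝ) ^ m) v := by
        intro x hx
        rw [Finset.HasAntidiagonal.mem_antidiagonal.1 hx]
      rw [Finset.sum_congr rfl this, ← Finset.sum_smul, alt_sum]
      by_cases hm : m = 0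
      · subst hm; simp
      · simp [hm]
    rw [finsum_congr e2, finsum_eq_single _ 0 (fun k hk => if_neg hk), if_pos rfl]
  · intro k p hk
    rw [hn _ (by omega), smul_zero]
  · intro k p hk
    rw [hn _ (by omega), smul_zero]

lemma hadamard {N : ℕ} (a : ℤ) (ha : 1 ≤ a) (f : ℤ → ℝ) (w : Fock ℝ) (hw : w ∈ VV (Adm N)) :
    expOp ℝ (alphaOne ℝ) (sumE ℝ a f w)
      = ∑ᶠ k : ℕ, ((k.factorial : ℝ)⁻¹) • Cop a f k (expOp ℝ (alphaOne ℝ) w) := by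
  obtain ⟨n, hn⟩ := alpha_nil w hw
  unfold expOp
  have e1 : ∀ m : ℕ, ((m.factorial : ℝ)⁻¹) • ((alphaOne ℝ) ^ m) (sumE ℝ a f w)
      = ∑ x ∈ Finset.HasAntidiagonal.antidiagonal m, (fun k p : ℕ => ((k.factorial : ℝ)⁻¹ * (p.factorial : ℝ)⁻¹) •
          Cop a f k (((alphaOne ℝ) ^ p) w)) x.1 x.2 := by
    intro m
    rw [Cop_pow a ha f m w hw, Finset.smul_sum]
    exact Finset.sum_congr rfl fun x hx => fact_smul m x hx _
  rw [finsum_congr e1, finsum_antidiag (fun k p : ℕ => ((k.factorial : ℝ)⁻¹ * (p.factorial : ℝ)⁻¹) •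
    Cop a f k (((alphaOne ℝ) ^ p) w)) (n + a.toNat + 2 * N + 1)]
  · apply finsum_congr
    intro k
    rw [map_finsum _ (exp_supp hn), smul_finsum]
    apply finsum_congr
    intro p
    rw [map_smul, smul_smul]
  · intro k p hk
    rw [Cop_apply, sumE_zero _ (by omega) _ _ (alpha_pow_mem p w hw), if_neg (by omega),
      zero_smul, add_zero, smul_zero]
  · intro k p hp
    rw [hn p (by omega), map_zero, smul_zero]

lemma sumE_div {N : ℕ} (b : ℤ) (g : ℤ → ℝ) (c : ℝ) (v : Fock ℝ) (hv : v ∈ VV (Adm N)) :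
    sumE ℝ b (fun l => g l / c) v = c⁻¹ • sumE ℝ b g v := by
  rw [sumE_apply _ _ v hv, sumE_apply _ _ v hv, smul_finsum]
  apply finsum_congr
  intro l
  rw [smul_smul, div_eq_inv_mul]

/-- for any positive integer `a` and function `f`:
`e^{α₁} (Σ_l f(l) E_{l+a,l}) e^{−α₁}
  = Σ_l Σ_{t≥0} (Δ^t f)(l)/t! · E_{l+a−t,l} + (Δ^{a−1} f)(−1/2)/a! · Id`,
as operators on the (charge-zero, admissible) basis states. -/
theorem conj_expAlpha_sumE (a : ℤ) (ha : 1 ≤ a) (f : ℤ → ℝ) (S : Set ℤ)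
    (hS : Admissible S) (hc : ChargeZero S) :
    expOp ℝ (alphaOne ℝ)
        ((sumE ℝ a f) (expOp ℝ (-(alphaOne ℝ)) (Finsupp.single S 1)))
    = (∑ᶠ t : ℕ, (sumE ℝ (a - t) (fun l => (bdiff ℝ)^[t] f l / (t.factorial : ℝ)))
          (Finsupp.single S 1)) +
        ((bdiff ℝ)^[(a - 1).toNat] f 0 / (a.toNat.factorial : ℝ)) •
          Finsupp.single S 1 := by
  obtain ⟨N, hN⟩ := exists_Adm hS
  have hv : Finsupp.single S (1 : ℝ) ∈ VV (Adm N) := VV_single hN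
  generalize Finsupp.single S (1 : ℝ) = v at hv ⊢
  have hw : expOp ℝ (-(alphaOne ℝ)) v ∈ VV (Adm N) := by
    unfold expOp
    apply finsum_mem_sub
    intro n
    apply Submodule.smul_mem
    rw [neg_pow_apply]
    exact Submodule.smul_mem _ _ (alpha_pow_mem n v hv)
  rw [hadamard a ha f _ hw, exp_cancel v hv]
  have e : ∀ k : ℕ, ((k.factorial : ℝ)⁻¹) • Cop a f k v
      = sumE ℝ (a - k) (fun l => (bdiff ℝ)^[k] f l / (k.factorial : ℝ)) v
        + (if k = a.toNat then
          ((bdiff ℝ)^[(a - 1).toNat] f 0 / (a.toNat.factorial : ℝ)) • v else 0) := by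
    intro k
    rw [Cop_apply, sumE_div _ _ _ v hv, smul_add]
    congr 1
    by_cases h : k = a.toNat
    · subst h
      rw [if_pos (by omega), if_pos rfl, smul_smul, div_eq_inv_mul]
    · rw [if_neg (by omega), if_neg h, zero_smul, smul_zero]
  rw [finsum_congr e, finsum_add_distrib]
  · congr 1
    rw [finsum_eq_single _ a.toNat (fun k hk => if_neg hk), if_pos rfl]
  · apply (Finset.range (a.toNat + 2 * N + 1)).finite_toSet.subset
    intro k hk
    by_contra hc
    apply hk
    have hc : a.toNat + 2 * N + 1 ≤ k := by simpa using hc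
    exact sumE_zero _ (by omega) _ v hv
  · apply (Set.finite_singleton a.toNat).subset
    intro k hk
    by_contra h
    exact hk (if_neg h)

end
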